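/- arXiv:2505.17948 — 5 statements merged into one kernel-verified Lean document; each statement's English description precedes it below -/
import Mathlib

section
/- Let a > 0, h > 0, γ > 0 and w ∈ ℝ. Then (1/a)·∫₀^a [1 − ∫₀^{(1−(x+w/2)/a)·h} (t/γ²)·exp(−t²/(2γ²)) dt] dx = √(π/2)·(γ/h)·[erf(w·h/(2√2·a·γ)) − erf((w−2a)·h/(2√2·a·γ))], where erf(x) = (2/√π)·∫₀^x exp(−t²) dt. -/
open Real

/-- The Gauss error function erf(x) = (2/√π)·∫₀^x exp(−t²) dt. -/
noncomputable def erf (x : ℝ) : ℝ :=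
  (2 / Real.sqrt Real.pi) * ∫ t in (0:ℝ)..x, Real.exp (-t ^ 2)

/-- The probability ξ that a building of width w blocking the 2D projection of a
user–UAV link of projected length a also blocks the 3D link, for a UAV at height h
and Rayleigh building heights with scale γ. -/
theorem blockage_probability (a h γ w : ℝ) (ha : 0 < a) (hh : 0 < h) (hγ : 0 < γ) :
    (1 / a) * ∫ x in (0:ℝ)..a,
        (1 - ∫ t in (0:ℝ)..((1 - (x + w / 2) / a) * h),
              (t / γ ^ 2) * Real.exp (-t ^ 2 / (2 * γ ^ 2))) =
      Real.sqrt (Real.pi / 2) * (γ / h) *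
        (erf (w * h / (2 * Real.sqrt 2 * a * γ)) -
          erf ((w - 2 * a) * h / (2 * Real.sqrt 2 * a * γ))) := by
  have inner : ∀ H : ℝ, (∫ t in (0:ℝ)..H, (t / γ ^ 2) * Real.exp (-t ^ 2 / (2 * γ ^ 2)))
      = 1 - Real.exp (-H ^ 2 / (2 * γ ^ 2)) := by
    intro H
    have hd : ∀ t ∈ Set.uIcc 0 H, HasDerivAt (fun t : ℝ => -Real.exp (-t ^ 2 / (2 * γ ^ 2)))
        ((t / γ ^ 2) * Real.exp (-t ^ 2 / (2 * γ ^ 2))) t := by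
      intro t _
      have h1 := ((((hasDerivAt_id t).pow 2).neg.div_const (2 * γ ^ 2)).exp).neg
      refine h1.congr_deriv ?_
      simp
      field_simp
    rw [intervalIntegral.integral_eq_sub_of_hasDerivAt hd
      (Continuous.intervalIntegrable (by fun_prop) _ _)]
    simp
    ring
  have h2 : (0:ℝ) < Real.sqrt 2 := by positivity
  have h22 : Real.sqrt 2 ^ 2 = 2 := Real.sq_sqrt (by norm_num)
  have hpi : (0:ℝ) < Real.sqrt Real.pi := Real.sqrt_pos.mpr Real.pi_pos
  have hc : h / (Real.sqrt 2 * a * γ) ≠ 0 := by positivity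
  have key : ∀ x : ℝ, (1 - ∫ t in (0:ℝ)..((1 - (x + w / 2) / a) * h),
        (t / γ ^ 2) * Real.exp (-t ^ 2 / (2 * γ ^ 2))) =
      (fun s : ℝ => Real.exp (-s ^ 2)) (h / (Real.sqrt 2 * a * γ) * x +
        (w - 2 * a) * h / (2 * Real.sqrt 2 * a * γ)) := by
    intro x
    rw [inner, sub_sub_cancel]
    have e : h / (Real.sqrt 2 * a * γ) * x + (w - 2 * a) * h / (2 * Real.sqrt 2 * a * γ)
        = -((1 - (x + w / 2) / a) * h) / (Real.sqrt 2 * γ) := by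
      field_simp
      ring
    simp only [e]
    rw [div_pow, mul_pow (Real.sqrt 2), h22, neg_sq, neg_div]
  simp_rw [key]
  rw [intervalIntegral.integral_comp_mul_add (fun s : ℝ => Real.exp (-s ^ 2)) hc]
  have e1 : h / (Real.sqrt 2 * a * γ) * a + (w - 2 * a) * h / (2 * Real.sqrt 2 * a * γ)
      = w * h / (2 * Real.sqrt 2 * a * γ) := by
    field_simp
    ring
  rw [e1, mul_zero, zero_add]
  have hi : ∀ p q : ℝ, IntervalIntegrable (fun s : ℝ => Real.exp (-s ^ 2))
      MeasureTheory.volume p q := fun p q => Continuous.intervalIntegrable (by fun_prop) _ _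
  unfold erf
  rw [← mul_sub, intervalIntegral.integral_interval_sub_left (hi _ _) (hi _ _),
    Real.sqrt_div Real.pi_pos.le, smul_eq_mul]
  generalize (∫ s in _.._, Real.exp (-s ^ 2)) = I
  field_simp
  rw [h22, mul_comm]
end

section
/- Let a > 0, h > 0, γ > 0 and w ∈ ℝ. Then 0 < √(π/2)·(γ/h)·[erf(w·h/(2√2·a·γ)) − erf((w−2a)·h/(2√2·a·γ))] < 1, where erf(x) = (2/√π)·∫₀^x exp(−t²) dt. -/
open Real

theorem erf_sub_aux (u v : ℝ) :
    erf u - erf v = (2 / Real.sqrt Real.pi) * ∫ t in v..u, Real.exp (-t ^ 2) := by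
  have hc : Continuous fun t : ℝ => Real.exp (-t ^ 2) := by fun_prop
  unfold erf
  rw [← mul_sub, intervalIntegral.integral_interval_sub_left
    (hc.intervalIntegrable _ _) (hc.intervalIntegrable _ _)]

theorem gauss_integral_lt_aux (u v : ℝ) (huv : v < u) :
    ∫ t in v..u, Real.exp (-t ^ 2) < u - v := by
  have hc : Continuous fun t : ℝ => Real.exp (-t ^ 2) := by fun_prop
  have key : ∫ t in v..u, Real.exp (-t ^ 2) < ∫ _t in v..u, (1 : ℝ) := by
    apply intervalIntegral.integral_lt_integral_of_continuousOn_of_le_of_exists_lt huv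
      hc.continuousOn continuousOn_const
    · intro x _
      exact Real.exp_le_one_iff.mpr (by nlinarith [sq_nonneg x])
    · by_cases hv : v = 0
      · refine ⟨u, ⟨huv.le, le_refl _⟩, Real.exp_lt_one_iff.mpr ?_⟩
        have : 0 < u := hv ▸ huv
        nlinarith [pow_pos this 2]
      · refine ⟨v, ⟨le_refl _, huv.le⟩, Real.exp_lt_one_iff.mpr ?_⟩
        have : 0 < v ^ 2 := by positivity
        linarith
  simpa using key

/-- The blockage probability ξ is strictly between 0 and 1. -/
theorem blockage_probability_mem_Ioo (a h γ w : ℝ) (ha : 0 < a) (hh : 0 < h) (hγ : 0 < γ) :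
    0 < Real.sqrt (Real.pi / 2) * (γ / h) *
          (erf (w * h / (2 * Real.sqrt 2 * a * γ)) -
            erf ((w - 2 * a) * h / (2 * Real.sqrt 2 * a * γ))) ∧
    Real.sqrt (Real.pi / 2) * (γ / h) *
          (erf (w * h / (2 * Real.sqrt 2 * a * γ)) -
            erf ((w - 2 * a) * h / (2 * Real.sqrt 2 * a * γ))) < 1 := by
  rw [erf_sub_aux]
  have hs2 : 0 < Real.sqrt 2 := by positivity
  have hsp : 0 < Real.sqrt Real.pi := Real.sqrt_pos.mpr Real.pi_pos
  have h22 : Real.sqrt 2 * Real.sqrt 2 = 2 := Real.mul_self_sqrt (by norm_num)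
  set u := w * h / (2 * Real.sqrt 2 * a * γ) with hu
  set v := (w - 2 * a) * h / (2 * Real.sqrt 2 * a * γ) with hv
  have hd : u - v = h / (Real.sqrt 2 * γ) := by
    rw [hu, hv]
    field_simp
    ring
  have hvu : v < u := by
    have : 0 < h / (Real.sqrt 2 * γ) := by positivity
    linarith
  have hc : Continuous fun t : ℝ => Real.exp (-t ^ 2) := by fun_prop
  have hpos : 0 < ∫ t in v..u, Real.exp (-t ^ 2) :=
    intervalIntegral.intervalIntegral_pos_of_pos (hc.intervalIntegrable _ _)
      (fun x => Real.exp_pos _) hvu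
  have hlt := gauss_integral_lt_aux u v hvu
  rw [hd] at hlt
  generalize (∫ t in v..u, Real.exp (-t ^ 2)) = I at hpos hlt ⊢
  have hpre : Real.sqrt (Real.pi / 2) * (γ / h) * (2 / Real.sqrt Real.pi * I)
      = I * (Real.sqrt 2 * γ) / h := by
    rw [Real.sqrt_div Real.pi_pos.le]
    field_simp
    nlinarith [h22]
  rw [hpre]
  refine ⟨by positivity, ?_⟩
  rw [div_lt_one hh]
  exact (lt_div_iff₀ (by positivity)).mp hlt
end

section
/- Let p ∈ ℝ³ with third coordinate p₃ > 0, and define the central projection π_p(q) = p + (p₃/(p₃ − q₃))·(q − p) for every q ∈ ℝ³ with third coordinate q₃ < p₃. Then for any q, q' ∈ ℝ³ with q₃ < p₃ and q'₃ < p₃, the image under π_p of the closed segment [q, q'] equals the closed segment [π_p(q), π_p(q')]. -/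
lemma cp_pos {a b d e : ℝ} (ha : 0 ≤ a) (hb : 0 ≤ b) (hab : a + b = 1) (hd : 0 < d)
    (he : 0 < e) : 0 < a * d + b * e := by
  rcases ha.eq_or_lt with h | h
  · have : b = 1 := by linarith
    subst h; subst this; linarith
  · have := mul_pos h hd
    have := mul_nonneg hb he.le
    linarith

lemma cp_coord {a b d e h x y w : ℝ} (hab : a + b = 1) (hd : d ≠ 0) (he : e ≠ 0)
    (hD : a * d + b * e ≠ 0) :
    (a * d / (a * d + b * e)) * (w + h / d * (x - w)) +
      (b * e / (a * d + b * e)) * (w + h / e * (y - w)) =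
    w + h / (a * d + b * e) * (a * x + b * y - w) := by
  obtain rfl : b = 1 - a := by linarith
  field_simp
  ring

lemma cp_key (p q q' : ℝ × ℝ × ℝ) {a b : ℝ} (ha : 0 ≤ a) (hb : 0 ≤ b) (hab : a + b = 1)
    (hq : q.2.2 < p.2.2) (hq' : q'.2.2 < p.2.2) :
    (a * (p.2.2 - q.2.2) / (a * (p.2.2 - q.2.2) + b * (p.2.2 - q'.2.2))) •
        (p + (p.2.2 / (p.2.2 - q.2.2)) • (q - p)) +
      (b * (p.2.2 - q'.2.2) / (a * (p.2.2 - q.2.2) + b * (p.2.2 - q'.2.2))) •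
        (p + (p.2.2 / (p.2.2 - q'.2.2)) • (q' - p)) =
    p + (p.2.2 / (p.2.2 - (a • q + b • q').2.2)) • (a • q + b • q' - p) := by
  have hd := sub_pos.2 hq
  have he := sub_pos.2 hq'
  have hD := cp_pos ha hb hab hd he
  have h3 : p.2.2 - (a • q + b • q').2.2 =
      a * (p.2.2 - q.2.2) + b * (p.2.2 - q'.2.2) := by
    simp only [Prod.snd_add, Prod.smul_snd, smul_eq_mul]
    linear_combination (-p.2.2) * hab
  rw [h3]
  refine Prod.ext ?_ (Prod.ext ?_ ?_) <;>
  · simp only [Prod.snd_add, Prod.fst_add, Prod.smul_snd, Prod.smul_fst, Prod.snd_sub,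
      Prod.fst_sub, smul_eq_mul]
    exact cp_coord hab hd.ne' he.ne' hD.ne'


/-- The central projection π_p(q) = p + (p₃/(p₃ − q₃))·(q − p) from an apex p with
p₃ > 0 onto the ground plane maps the closed segment [q, q'] (for q, q' strictly
below the apex) onto the closed segment [π_p(q), π_p(q')]. -/
theorem central_projection_segment (p q q' : ℝ × ℝ × ℝ) (hp : 0 < p.2.2)
    (hq : q.2.2 < p.2.2) (hq' : q'.2.2 < p.2.2) :
    (fun z : ℝ × ℝ × ℝ => p + (p.2.2 / (p.2.2 - z.2.2)) • (z - p)) '' segment ℝ q q' =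
      segment ℝ (p + (p.2.2 / (p.2.2 - q.2.2)) • (q - p))
        (p + (p.2.2 / (p.2.2 - q'.2.2)) • (q' - p)) := by
  have hd := sub_pos.2 hq
  have he := sub_pos.2 hq'
  apply Set.Subset.antisymm
  · rintro _ ⟨_, ⟨a, b, ha, hb, hab, rfl⟩, rfl⟩
    have hD := cp_pos ha hb hab hd he
    refine ⟨_, _, ?_, ?_, ?_, cp_key p q q' ha hb hab hq hq'⟩
    · positivity
    · positivity
    · rw [← add_div, div_self hD.ne']
  · rintro _ ⟨c, f, hc, hf, hcf, rfl⟩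
    have hS := cp_pos hc hf hcf he hd
    have k := fun ha hb hab => cp_key p q q'
      (a := c * (p.2.2 - q'.2.2) / (c * (p.2.2 - q'.2.2) + f * (p.2.2 - q.2.2)))
      (b := f * (p.2.2 - q.2.2) / (c * (p.2.2 - q'.2.2) + f * (p.2.2 - q.2.2)))
      ha hb hab hq hq'
    generalize p.2.2 - q.2.2 = d at *
    generalize p.2.2 - q'.2.2 = e at *
    have ha : 0 ≤ c * e / (c * e + f * d) := by positivity
    have hb : 0 ≤ f * d / (c * e + f * d) := by positivity
    have hab : c * e / (c * e + f * d) + f * d / (c * e + f * d) = 1 := by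
      rw [← add_div, div_self hS.ne']
    refine ⟨_, ⟨_, _, ha, hb, hab, rfl⟩, ?_⟩
    have hD : c * e / (c * e + f * d) * d + f * d / (c * e + f * d) * e
        = d * e / (c * e + f * d) := by
      obtain rfl : f = 1 - c := by linarith
      field_simp
      ring
    have h1 : c * e / (c * e + f * d) * d / (d * e / (c * e + f * d)) = c := by
      field_simp
    have h2 : f * d / (c * e + f * d) * e / (d * e / (c * e + f * d)) = f := by
      field_simp
    have k' := k ha hb hab
    rw [hD, h1, h2] at k'
    exact k'.symm
end

section
/- Let p ∈ ℝ³ with third coordinate p₃ > 0, and define the central projection π_p(q) = p + (p₃/(p₃ − q₃))·(q − p) for every q ∈ ℝ³ with third coordinate q₃ < p₃. If C ⊆ {q ∈ ℝ³ : q₃ < p₃} is a convex set, then the image π_p(C) is convex. -/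
/-- The central projection π_p(q) = p + (p₃/(p₃ − q₃))·(q − p) from an apex p with
p₃ > 0 onto the ground plane maps convex subsets of the open half-space below the
apex to convex sets. -/
theorem central_projection_convex (p : ℝ × ℝ × ℝ) (hp : 0 < p.2.2)
    (C : Set (ℝ × ℝ × ℝ)) (hC : Convex ℝ C) (hCp : C ⊆ {q : ℝ × ℝ × ℝ | q.2.2 < p.2.2}) :
    Convex ℝ ((fun z : ℝ × ℝ × ℝ => p + (p.2.2 / (p.2.2 - z.2.2)) • (z - p)) '' C) := by
  rintro _ ⟨x, hx, rfl⟩ _ ⟨y, hy, rfl⟩ a b ha hb hab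
  have hu : 0 < p.2.2 - x.2.2 := sub_pos.mpr (hCp hx)
  have hv : 0 < p.2.2 - y.2.2 := sub_pos.mpr (hCp hy)
  obtain ⟨u, hu'⟩ : ∃ u, u = p.2.2 - x.2.2 := ⟨_, rfl⟩
  obtain ⟨v, hv'⟩ : ∃ v, v = p.2.2 - y.2.2 := ⟨_, rfl⟩
  rw [← hu'] at hu
  rw [← hv'] at hv
  have hD : 0 < a * v + b * u := by
    rcases ha.eq_or_lt with h | h
    · have : b = 1 := by linarith
      subst this
      subst h
      linarith
    · have := mul_pos h hv
      have := mul_nonneg hb hu.le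
      linarith
  obtain ⟨D, hD'⟩ : ∃ D, D = a * v + b * u := ⟨_, rfl⟩
  rw [← hD'] at hD
  have hst : a * v / D + b * u / D = 1 := by
    rw [← add_div, ← hD', div_self hD.ne']
  refine ⟨(a * v / D) • x + (b * u / D) • y,
    hC hx hy (by positivity) (by positivity) hst, ?_⟩
  have hw : p.2.2 - ((a * v / D) • x + (b * u / D) • y).2.2 = u * v / D := by
    simp only [Prod.snd_add, Prod.smul_snd, smul_eq_mul]
    have h1 : x.2.2 = p.2.2 - u := by linarith
    have h2 : y.2.2 = p.2.2 - v := by linarith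
    rw [h1, h2]
    have : u * v / D = a * v / D * u + b * u / D * v := by
      have hb' : b = 1 - a := by linarith
      rw [hb']
      ring
    rw [this]
    linear_combination (-p.2.2) * hst
  have hsub : (a * v / D) • x + (b * u / D) • y - p
      = (a * v / D) • (x - p) + (b * u / D) • (y - p) := by
    have : p = (a * v / D + b * u / D) • p := by rw [hst, one_smul]
    nth_rewrite 1 [this]
    module
  have hpp : p = a • p + b • p := by rw [← add_smul, hab, one_smul]
  have e1 : p.2.2 / (u * v / D) * (a * v / D) = a * (p.2.2 / u) := by
    field_simp
  have e2 : p.2.2 / (u * v / D) * (b * u / D) = b * (p.2.2 / v) := by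
    field_simp
  show p + (p.2.2 / (p.2.2 - ((a * v / D) • x + (b * u / D) • y).2.2)) •
      ((a * v / D) • x + (b * u / D) • y - p)
    = a • (p + (p.2.2 / (p.2.2 - x.2.2)) • (x - p))
      + b • (p + (p.2.2 / (p.2.2 - y.2.2)) • (y - p))
  rw [hw, hsub, ← hu', ← hv', smul_add, smul_smul, smul_smul, e1, e2,
    smul_add a, smul_add b, smul_smul, smul_smul, add_add_add_comm, ← hpp]
end

section
/- Let p ∈ ℝ³ with third coordinate p₃ > 0, and define the central projection π_p(q) = p + (p₃/(p₃ − q₃))·(q − p) for every q ∈ ℝ³ with third coordinate q₃ < p₃. Then for every set S ⊆ {q ∈ ℝ³ : q₃ < p₃}, the image of the convex hull of S under π_p equals the convex hull of the image π_p(S); in particular, the shadow of a cuboid (the convex hull of its 8 vertices, all with third coordinate < p₃) with respect to the UAV at p is the convex hull of the projections of its 8 vertices. -/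
/-- The image of a convex combination is an explicit convex combination of the images. -/
lemma proj_comb (p x y : ℝ × ℝ × ℝ) (hx : x.2.2 < p.2.2) (hy : y.2.2 < p.2.2) (a b : ℝ)
    (ha : 0 ≤ a) (hb : 0 ≤ b) (hab : a + b = 1) :
    0 < a * (p.2.2 - x.2.2) + b * (p.2.2 - y.2.2) ∧
    p + (p.2.2 / (p.2.2 - (a • x + b • y).2.2)) • ((a • x + b • y) - p) =
      (a * (p.2.2 - x.2.2) / (a * (p.2.2 - x.2.2) + b * (p.2.2 - y.2.2))) •
        (p + (p.2.2 / (p.2.2 - x.2.2)) • (x - p)) +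
      (b * (p.2.2 - y.2.2) / (a * (p.2.2 - x.2.2) + b * (p.2.2 - y.2.2))) •
        (p + (p.2.2 / (p.2.2 - y.2.2)) • (y - p)) := by
  have hu : 0 < p.2.2 - x.2.2 := sub_pos.2 hx
  have hv : 0 < p.2.2 - y.2.2 := sub_pos.2 hy
  have hD : 0 < a * (p.2.2 - x.2.2) + b * (p.2.2 - y.2.2) := by
    rcases ha.lt_or_eq with h | h
    · positivity
    · have : b = 1 := by linarith
      subst this
      positivity
  refine ⟨hD, ?_⟩
  have hz : p.2.2 - (a • x + b • y).2.2 = a * (p.2.2 - x.2.2) + b * (p.2.2 - y.2.2) := by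
    simp only [Prod.snd_add, Prod.smul_snd, smul_eq_mul]
    linear_combination (-p.2.2) * hab
  have hzp : (a • x + b • y) - p = a • (x - p) + b • (y - p) := by
    have : p = (a + b) • p := by rw [hab, one_smul]
    nth_rewrite 1 [this]
    module
  rw [hz, hzp]
  generalize x - p = X
  generalize y - p = Y
  generalize p.2.2 - x.2.2 = u at *
  generalize p.2.2 - y.2.2 = v at *
  generalize p.2.2 = h
  match_scalars <;> field_simp

lemma proj_hull (p : ℝ × ℝ × ℝ) (S : Set (ℝ × ℝ × ℝ))
    (hS : S ⊆ {q : ℝ × ℝ × ℝ | q.2.2 < p.2.2}) :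
    (fun z : ℝ × ℝ × ℝ => p + (p.2.2 / (p.2.2 - z.2.2)) • (z - p)) '' (convexHull ℝ S) =
      convexHull ℝ
        ((fun z : ℝ × ℝ × ℝ => p + (p.2.2 / (p.2.2 - z.2.2)) • (z - p)) '' S) := by
  have below : ∀ x y : ℝ × ℝ × ℝ, x.2.2 < p.2.2 → y.2.2 < p.2.2 → ∀ a b : ℝ, 0 ≤ a → 0 ≤ b →
      a + b = 1 → (a • x + b • y).2.2 < p.2.2 := by
    intro x y hx hy a b ha hb hab
    have h := (proj_comb p x y hx hy a b ha hb hab).1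
    simp only [Prod.snd_add, Prod.smul_snd, smul_eq_mul]
    have : (a + b) * p.2.2 = p.2.2 := by rw [hab, one_mul]
    linarith
  have hH : convexHull ℝ S ⊆ {q : ℝ × ℝ × ℝ | q.2.2 < p.2.2} :=
    convexHull_min hS fun x hx y hy a b ha hb hab => below x y hx hy a b ha hb hab
  apply Set.Subset.antisymm
  · have key : convexHull ℝ S ⊆ {z : ℝ × ℝ × ℝ | z.2.2 < p.2.2 ∧
        p + (p.2.2 / (p.2.2 - z.2.2)) • (z - p) ∈ convexHull ℝ
          ((fun z : ℝ × ℝ × ℝ => p + (p.2.2 / (p.2.2 - z.2.2)) • (z - p)) '' S)} := by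
      apply convexHull_min
      · exact fun x hx => ⟨hS hx, subset_convexHull ℝ _ ⟨x, hx, rfl⟩⟩
      · rintro x ⟨hx, hx'⟩ y ⟨hy, hy'⟩ a b ha hb hab
        refine ⟨below x y hx hy a b ha hb hab, ?_⟩
        obtain ⟨hD, h⟩ := proj_comb p x y hx hy a b ha hb hab
        rw [h]
        have hu := sub_pos.2 hx
        have hv := sub_pos.2 hy
        exact convex_convexHull ℝ _ hx' hy' (by positivity) (by positivity)
          (by rw [← add_div, div_self hD.ne'])
    rintro _ ⟨z, hz, rfl⟩
    exact (key hz).2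
  · apply convexHull_min (Set.image_mono (subset_convexHull ℝ S))
    rintro _ ⟨x, hx, rfl⟩ _ ⟨y, hy, rfl⟩ c d hc hd hcd
    have hu : 0 < p.2.2 - x.2.2 := sub_pos.2 (hH hx)
    have hv : 0 < p.2.2 - y.2.2 := sub_pos.2 (hH hy)
    have hE : 0 < c * (p.2.2 - y.2.2) + d * (p.2.2 - x.2.2) := by
      rcases hc.lt_or_eq with h | h
      · positivity
      · have : d = 1 := by linarith
        subst this
        positivity
    have ha : 0 ≤ c * (p.2.2 - y.2.2) / (c * (p.2.2 - y.2.2) + d * (p.2.2 - x.2.2)) := by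
      positivity
    have hb : 0 ≤ d * (p.2.2 - x.2.2) / (c * (p.2.2 - y.2.2) + d * (p.2.2 - x.2.2)) := by
      positivity
    have hab : c * (p.2.2 - y.2.2) / (c * (p.2.2 - y.2.2) + d * (p.2.2 - x.2.2)) +
        d * (p.2.2 - x.2.2) / (c * (p.2.2 - y.2.2) + d * (p.2.2 - x.2.2)) = 1 := by
      rw [← add_div, div_self hE.ne']
    refine ⟨_, convex_convexHull ℝ S hx hy ha hb hab, ?_⟩
    have h := (proj_comb p x y (hH hx) (hH hy) _ _ ha hb hab).2
    refine h.trans ?_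
    have hd' : d = 1 - c := by linarith
    clear h ha hb hab
    dsimp only
    generalize p.2.2 - x.2.2 = u at *
    generalize p.2.2 - y.2.2 = v at *
    have hsum : c * v / (c * v + d * u) * u + d * u / (c * v + d * u) * v
        = u * v / (c * v + d * u) := by
      field_simp
      linear_combination hcd
    rw [hsum]
    congr 2 <;> field_simp

/-- The central projection π_p(q) = p + (p₃/(p₃ − q₃))·(q − p) from an apex p with
p₃ > 0 onto the ground plane commutes with convex hulls of sets lying strictly
below the apex; in particular, the shadow of a cuboid (the convex hull of its 8
vertices) is the convex hull of the projections of its 8 vertices. -/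
theorem central_projection_convexHull (p : ℝ × ℝ × ℝ) (hp : 0 < p.2.2) :
    (∀ S : Set (ℝ × ℝ × ℝ), S ⊆ {q : ℝ × ℝ × ℝ | q.2.2 < p.2.2} →
      (fun z : ℝ × ℝ × ℝ => p + (p.2.2 / (p.2.2 - z.2.2)) • (z - p)) '' (convexHull ℝ S) =
        convexHull ℝ
          ((fun z : ℝ × ℝ × ℝ => p + (p.2.2 / (p.2.2 - z.2.2)) • (z - p)) '' S)) ∧
    (∀ V : Fin 8 → ℝ × ℝ × ℝ, (∀ i, (V i).2.2 < p.2.2) →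
      (fun z : ℝ × ℝ × ℝ => p + (p.2.2 / (p.2.2 - z.2.2)) • (z - p)) ''
          (convexHull ℝ (Set.range V)) =
        convexHull ℝ
          ((fun z : ℝ × ℝ × ℝ => p + (p.2.2 / (p.2.2 - z.2.2)) • (z - p)) ''
            Set.range V)) := by
  refine ⟨fun S hS => proj_hull p S hS, fun V hV => proj_hull p _ ?_⟩
  rintro _ ⟨i, rfl⟩
  exact hV i
end
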